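/- arXiv:2409.18391 — 3 statements merged into one kernel-verified Lean document; each statement's English description precedes it below -/
import Mathlib

section
/- Let c₀ ≥ 0 and α, λ, C, k > 0; set γ = c₀ + α²/λ and L = 1/((c₀λ/α² + 1)·(Cλ + 1)). Let A, B, D : ℕ → ℝ be sequences of nonnegative reals such that for every i ≥ 1: (i) γ·A_i + (k/2)·B_i ≤ (α/λ)·√(A_i·D_{i-1}), and (ii) (C + 1/λ)·√(D_i) ≤ (α/λ)·√(A_i). Then √(D_i) ≤ L·√(D_{i-1}) for all i ≥ 1; consequently D_i ≤ L^{2i}·D_0, and both D_i → 0 and B_i → 0 as i → ∞. -/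
open Filter

/-- Sequence-level formulation of Theorem 3.1. -/
theorem stmt_3 (c₀ α lam C k : ℝ)
    (hc₀ : 0 ≤ c₀) (hα : 0 < α) (hlam : 0 < lam) (hC : 0 < C) (hk : 0 < k)
    (A B D : ℕ → ℝ) (hA : ∀ i, 0 ≤ A i) (hB : ∀ i, 0 ≤ B i) (hD : ∀ i, 0 ≤ D i)
    (h1 : ∀ i, 1 ≤ i →
      (c₀ + α ^ 2 / lam) * A i + (k / 2) * B i ≤ (α / lam) * Real.sqrt (A i * D (i - 1)))
    (h2 : ∀ i, 1 ≤ i →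
      (C + 1 / lam) * Real.sqrt (D i) ≤ (α / lam) * Real.sqrt (A i)) :
    (∀ i, 1 ≤ i → Real.sqrt (D i)
        ≤ (1 / ((c₀ * lam / α ^ 2 + 1) * (C * lam + 1))) * Real.sqrt (D (i - 1))) ∧
    (∀ i, D i ≤ (1 / ((c₀ * lam / α ^ 2 + 1) * (C * lam + 1))) ^ (2 * i) * D 0) ∧
    Tendsto D atTop (nhds 0) ∧ Tendsto B atTop (nhds 0) := by
  have hflow : ∀ i, 1 ≤ i → (c₀ * lam + α ^ 2) * √(A i) ≤ α * √(D (i - 1)) := by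
    intro i hi
    have h := h1 i hi
    rw [Real.sqrt_mul (hA i)] at h
    have hsq := Real.sq_sqrt (hA i)
    have hBi : 0 ≤ k / 2 * B i := mul_nonneg (by positivity) (hB i)
    rcases (Real.sqrt_nonneg (A i)).eq_or_lt with h0 | hpos
    · rw [← h0, mul_zero]
      positivity
    · have hle : (c₀ + α ^ 2 / lam) * √(A i) ^ 2 ≤ α / lam * (√(A i) * √(D (i - 1))) := by
        rw [hsq]
        linarith
      refine le_of_mul_le_mul_right ?_ hpos
      have hmul := mul_le_mul_of_nonneg_left hle hlam.le
      field_simp at hmul ⊢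
      linarith
  have hcontr : ∀ i, 1 ≤ i → √(D i)
      ≤ (1 / ((c₀ * lam / α ^ 2 + 1) * (C * lam + 1))) * √(D (i - 1)) := by
    intro i hi
    have hstokes : (C * lam + 1) * √(D i) ≤ α * √(A i) := by
      have h := mul_le_mul_of_nonneg_left (h2 i hi) hlam.le
      have hl : lam * ((C + 1 / lam) * √(D i)) = (C * lam + 1) * √(D i) := by field_simp
      have hr : lam * (α / lam * √(A i)) = α * √(A i) := by field_simp
      rwa [hl, hr] at h
    rw [one_div_mul_eq_div, le_div_iff₀ (by positivity)]
    calc √(D i) * ((c₀ * lam / α ^ 2 + 1) * (C * lam + 1))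
        = (c₀ * lam / α ^ 2 + 1) * ((C * lam + 1) * √(D i)) := by ring
      _ ≤ (c₀ * lam / α ^ 2 + 1) * (α * √(A i)) := by gcongr
      _ = ((c₀ * lam + α ^ 2) * √(A i)) / α := by field_simp
      _ ≤ √(D (i - 1)) := by
        rw [div_le_iff₀ hα]
        linarith [hflow i hi]
  have hL0 : 0 ≤ 1 / ((c₀ * lam / α ^ 2 + 1) * (C * lam + 1)) := by positivity
  have hL1 : 1 / ((c₀ * lam / α ^ 2 + 1) * (C * lam + 1)) < 1 := by
    rw [div_lt_one (by positivity)]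
    have hq : 0 ≤ c₀ * lam / α ^ 2 := by positivity
    have hp : 0 < C * lam := by positivity
    nlinarith [mul_nonneg hq hp.le]
  set L := 1 / ((c₀ * lam / α ^ 2 + 1) * (C * lam + 1))
  have hgeom : ∀ i, D i ≤ L ^ (2 * i) * D 0 := by
    intro i
    induction i with
    | zero => simp
    | succ n ih =>
      have h := hcontr (n + 1) (by omega)
      rw [Nat.add_sub_cancel] at h
      calc D (n + 1) = √(D (n + 1)) ^ 2 := (Real.sq_sqrt (hD _)).symm
        _ ≤ (L * √(D n)) ^ 2 := by gcongr
        _ = L ^ 2 * D n := by rw [mul_pow, Real.sq_sqrt (hD n)]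
        _ ≤ L ^ 2 * (L ^ (2 * n) * D 0) := by gcongr
        _ = L ^ (2 * (n + 1)) * D 0 := by ring
  have hDlim : Tendsto D atTop (nhds 0) := by
    refine squeeze_zero hD hgeom ?_
    have h := (tendsto_pow_atTop_nhds_zero_of_lt_one (sq_nonneg L)
      (pow_lt_one₀ hL0 hL1 two_ne_zero)).mul_const (D 0)
    simpa only [pow_mul, zero_mul] using h
  have hBle : ∀ n, B (n + 1) ≤ 2 / (k * lam) * D n := by
    intro n
    have h := h1 (n + 1) (by omega)
    have hf := hflow (n + 1) (by omega)
    rw [Nat.add_sub_cancel] at h hf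
    rw [Real.sqrt_mul (hA _)] at h
    have hαA : α * √(A (n + 1)) ≤ √(D n) := by
      refine le_of_mul_le_mul_left ?_ hα
      have hnn : 0 ≤ c₀ * lam * √(A (n + 1)) := by positivity
      linarith
    have hγA : 0 ≤ (c₀ + α ^ 2 / lam) * A (n + 1) := mul_nonneg (by positivity) (hA _)
    have hkB : k / 2 * B (n + 1) ≤ D n / lam :=
      calc k / 2 * B (n + 1) ≤ α / lam * (√(A (n + 1)) * √(D n)) := by linarith
        _ = (α * √(A (n + 1))) * √(D n) / lam := by ring
        _ ≤ √(D n) * √(D n) / lam := by gcongr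
        _ = D n / lam := by rw [Real.mul_self_sqrt (hD n)]
    calc B (n + 1) = 2 / k * (k / 2 * B (n + 1)) := by field_simp
      _ ≤ 2 / k * (D n / lam) := by gcongr
      _ = 2 / (k * lam) * D n := by field_simp
  refine ⟨hcontr, hgeom, hDlim, (tendsto_add_atTop_iff_nat 1).mp ?_⟩
  refine squeeze_zero (fun n => hB (n + 1)) hBle ?_
  simpa only [mul_zero] using hDlim.const_mul (2 / (k * lam))
end

section
/- Let c₀ ≥ 0 and α, λ, C̃, k_p, Δt, C_P > 0 be reals, and set L_s = 1/((c₀λ/α² + k_pΔtλ/(2C_P²α²) + 1)·(C̃λ + 1)). If nonnegative reals x, z, y satisfy (c₀ + α²/λ + k_pΔt/(2C_P²))·z ≤ (α/λ)·y and (C̃ + 1/λ)·x ≤ (α/λ)·z, then x ≤ L_s·y; moreover 0 < L_s < 1. -/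
/-- Real-number core of Theorem 3.2. -/
theorem stmt_4 (c₀ α lam Ct kp Δt CP x z y : ℝ)
    (hc₀ : 0 ≤ c₀) (hα : 0 < α) (hlam : 0 < lam) (hCt : 0 < Ct)
    (hkp : 0 < kp) (hΔt : 0 < Δt) (hCP : 0 < CP)
    (hx : 0 ≤ x) (hz : 0 ≤ z) (hy : 0 ≤ y)
    (h1 : (c₀ + α ^ 2 / lam + kp * Δt / (2 * CP ^ 2)) * z ≤ (α / lam) * y)
    (h2 : (Ct + 1 / lam) * x ≤ (α / lam) * z) :
    x ≤ (1 / ((c₀ * lam / α ^ 2 + kp * Δt * lam / (2 * CP ^ 2 * α ^ 2) + 1) *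
          (Ct * lam + 1))) * y ∧
    0 < 1 / ((c₀ * lam / α ^ 2 + kp * Δt * lam / (2 * CP ^ 2 * α ^ 2) + 1) *
          (Ct * lam + 1)) ∧
    1 / ((c₀ * lam / α ^ 2 + kp * Δt * lam / (2 * CP ^ 2 * α ^ 2) + 1) *
          (Ct * lam + 1)) < 1 := by
  set A := c₀ * lam / α ^ 2 + kp * Δt * lam / (2 * CP ^ 2 * α ^ 2) + 1 with hA
  set B := Ct * lam + 1 with hB
  have hA1 : 1 < A := by
    have h₀ : 0 ≤ c₀ * lam / α ^ 2 := by positivity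
    have h₁ : 0 < kp * Δt * lam / (2 * CP ^ 2 * α ^ 2) := by positivity
    linarith
  have hB1 : 1 < B := by
    have h₀ : 0 < Ct * lam := by positivity
    linarith
  have hAB : 1 < A * B := one_lt_mul_of_lt_of_le hA1 hB1.le
  have hAB0 : 0 < A * B := one_pos.trans hAB
  have hAz : A * (α * z) ≤ y := by
    have h := mul_le_mul_of_nonneg_left h1 (div_pos hlam hα).le
    have hl : lam / α * ((c₀ + α ^ 2 / lam + kp * Δt / (2 * CP ^ 2)) * z) = A * (α * z) := by
      rw [hA]
      field_simp
      ring
    have hr : lam / α * (α / lam * y) = y := by field_simp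
    rwa [hl, hr] at h
  have hBx : B * x ≤ α * z := by
    have h := mul_le_mul_of_nonneg_left h2 hlam.le
    have hl : lam * ((Ct + 1 / lam) * x) = B * x := by
      rw [hB]
      field_simp
    have hr : lam * (α / lam * z) = α * z := by field_simp
    rwa [hl, hr] at h
  refine ⟨?_, one_div_pos.mpr hAB0, (div_lt_one hAB0).mpr hAB⟩
  rw [one_div_mul_eq_div, le_div_iff₀ hAB0]
  calc x * (A * B) = A * (B * x) := by ring
    _ ≤ A * (α * z) := by gcongr
    _ ≤ y := hAz
end

section
/- Let E be a real inner product space, c₀ ≥ 0, and α, λ, C̃, k_p, Δt, C_P > 0. Let p, ξ, η ∈ E and q ∈ ℝ with q ≥ (k_p/C_P²)·‖p‖². If (c₀ + α²/λ)·‖p‖² + (Δt/2)·q ≤ (α/λ)·⟪p, η⟫ and (C̃ + 1/λ)·‖ξ‖² ≤ (α/λ)·⟪p, ξ⟫, then ‖ξ‖ ≤ L_s·‖η‖, where L_s = 1/((c₀λ/α² + k_pΔtλ/(2C_P²α²) + 1)·(C̃λ + 1)). -/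
open RealInnerProductSpace

lemma mul_le_of_mul_sq_le_mul {a x y : ℝ} (hx : 0 ≤ x) (hy : 0 ≤ y)
    (h : a * x ^ 2 ≤ x * y) : a * x ≤ y := by
  rcases hx.eq_or_lt with rfl | hx
  · simpa using hy
  · exact le_of_mul_le_mul_left (by linarith) hx

/-- Inner-product-space formulation of Theorem 3.2. -/
theorem stmt_5 {E : Type*} [NormedAddCommGroup E] [InnerProductSpace ℝ E]
    (c₀ α lam Ct kp Δt CP : ℝ)
    (hc₀ : 0 ≤ c₀) (hα : 0 < α) (hlam : 0 < lam) (hCt : 0 < Ct)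
    (hkp : 0 < kp) (hΔt : 0 < Δt) (hCP : 0 < CP)
    (p ξ η : E) (q : ℝ) (hq : (kp / CP ^ 2) * ‖p‖ ^ 2 ≤ q)
    (h1 : (c₀ + α ^ 2 / lam) * ‖p‖ ^ 2 + (Δt / 2) * q ≤ (α / lam) * ⟪p, η⟫)
    (h2 : (Ct + 1 / lam) * ‖ξ‖ ^ 2 ≤ (α / lam) * ⟪p, ξ⟫) :
    ‖ξ‖ ≤ (1 / ((c₀ * lam / α ^ 2 + kp * Δt * lam / (2 * CP ^ 2 * α ^ 2) + 1) *
        (Ct * lam + 1))) * ‖η‖ := by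
  set X := c₀ * lam / α ^ 2 + kp * Δt * lam / (2 * CP ^ 2 * α ^ 2) + 1 with hX
  have hXpos : 0 < X := by positivity
  have hp : X * α * ‖p‖ ≤ ‖η‖ := by
    apply mul_le_of_mul_sq_le_mul (norm_nonneg _) (norm_nonneg _)
    refine le_trans ?_ (real_inner_le_norm p η)
    have hcoef : (α / lam) * (X * α * ‖p‖ ^ 2) =
        (c₀ + α ^ 2 / lam) * ‖p‖ ^ 2 + (Δt / 2) * ((kp / CP ^ 2) * ‖p‖ ^ 2) := by
      rw [hX]
      field_simp
      ring
    have hq' := mul_le_mul_of_nonneg_left hq (half_pos hΔt).le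
    exact le_of_mul_le_mul_left (by linarith) (div_pos hα hlam)
  have hξ : (Ct * lam + 1) * ‖ξ‖ ≤ α * ‖p‖ := by
    apply mul_le_of_mul_sq_le_mul (norm_nonneg _) (by positivity)
    have hcoef : (Ct * lam + 1) * ‖ξ‖ ^ 2 = lam * ((Ct + 1 / lam) * ‖ξ‖ ^ 2) := by
      field_simp
    calc (Ct * lam + 1) * ‖ξ‖ ^ 2 ≤ lam * ((α / lam) * ⟪p, ξ⟫) := by
          rw [hcoef]
          gcongr
      _ = α * ⟪p, ξ⟫ := by field_simp
      _ ≤ α * (‖p‖ * ‖ξ‖) := by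
          gcongr
          exact real_inner_le_norm p ξ
      _ = ‖ξ‖ * (α * ‖p‖) := by ring
  rw [one_div_mul_eq_div, le_div_iff₀ (by positivity)]
  calc ‖ξ‖ * (X * (Ct * lam + 1)) = X * ((Ct * lam + 1) * ‖ξ‖) := by ring
    _ ≤ X * (α * ‖p‖) := by gcongr
    _ = X * α * ‖p‖ := by ring
    _ ≤ ‖η‖ := hp
end
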